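/- Let g be a vector of N independent standard Gaussian random variables, A a real N×N matrix, φ = A g, and H = A Aᵀ. Let ε be a centered Gaussian random variable with variance σ² ≥ 0, independent of g. Fix e ∈ ℝ^N and define the random vector X = (⟨φ, e⟩ − ε)·φ. Then: (i) E[X] = H e; (ii) the covariance matrix of X equals H e eᵀ H + (eᵀ H e)·H + σ²·H; and (iii) in the Loewner order, (eᵀ H e + σ²)·H ⪯ Cov(X) ⪯ (2 eᵀ H e + σ²)·H. In particular, for every eigenvector v_j of H with eigenvalue λ_j and ‖v_j‖ = 1, (eᵀ H e + σ²)·λ_j ≤ v_jᵀ Cov(X) v_j ≤ (2 eᵀ H e + σ²)·λ_j. -/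

import Mathlib

open MeasureTheory ProbabilityTheory Matrix

lemma MeasureTheory.Integrable.fun_subF {α : Type*} [MeasurableSpace α] {μ : Measure α}
    {f g : α → ℝ} (hf : Integrable f μ) (hg : Integrable g μ) :
    Integrable (fun x ↦ f x - g x) μ := hf.sub hg

lemma moment4_gaussianReal (v : NNReal) : ∫ x, x ^ 4 ∂(gaussianReal 0 v) = 3 * (v : ℝ) ^ 2 := by
  have h : ∫ x, x ^ 4 ∂(gaussianReal 0 v)
      = iteratedDeriv 4 (mgf (fun x ↦ x) (gaussianReal 0 v)) 0 := by
    rw [iteratedDeriv_mgf_zero] <;> simp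
  have hd : ∀ (p dp : ℝ → ℝ), (∀ t, HasDerivAt p (dp t) t) →
      deriv (fun t : ℝ ↦ p t * Real.exp (v * t ^ 2 / 2))
        = fun t ↦ (dp t + v * t * p t) * Real.exp (v * t ^ 2 / 2) := by
    intro p dp hp
    ext t
    have h1 : HasDerivAt (fun t : ℝ ↦ (v : ℝ) * t ^ 2 / 2) (v * t) t := by
      have := (((hasDerivAt_id t).pow 2).const_mul (v : ℝ)).div_const 2
      convert! this using 1
      simp
      ring
    rw [((hp t).fun_mul h1.exp).deriv]
    ring
  rw [h, mgf_fun_id_gaussianReal]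
  have e0 : (fun t : ℝ ↦ Real.exp (0 * t + v * t ^ 2 / 2))
      = fun t ↦ (1 : ℝ) * Real.exp (v * t ^ 2 / 2) := by ext t; simp
  rw [e0, iteratedDeriv_succ, iteratedDeriv_succ, iteratedDeriv_succ, iteratedDeriv_one]
  rw [hd (fun _ ↦ 1) (fun _ ↦ 0) (fun t ↦ hasDerivAt_const _ _)]
  rw [hd (fun t ↦ 0 + v * t * 1) (fun _ ↦ v) (fun t ↦ by
    simpa using (hasDerivAt_id t).const_mul (v : ℝ))]
  rw [hd (fun t ↦ v + v * t * (0 + v * t * 1)) (fun t ↦ 2 * v ^ 2 * t) (fun t ↦ by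
    have := (((hasDerivAt_id t).pow 2).const_mul ((v : ℝ) ^ 2)).const_add (v : ℝ)
    convert! this using 1
    · ext x; simp; ring
    · simp; ring)]
  rw [hd (fun t ↦ 2 * v ^ 2 * t + v * t * (v + v * t * (0 + v * t * 1)))
    (fun t ↦ 3 * v ^ 2 + 3 * v ^ 3 * t ^ 2) (fun t ↦ by
    have := (((hasDerivAt_id t).pow 3).const_mul ((v : ℝ) ^ 3)).add
      ((hasDerivAt_id t).const_mul (3 * (v : ℝ) ^ 2))
    convert! this using 1
    · ext x; simp; ring
    · simp; ring)]
  simp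

section
variable {E : Type*} [NormedAddCommGroup E] [NormedSpace ℝ E] [MeasurableSpace E] [BorelSpace E]
  {μ : Measure E} [IsGaussian μ]

lemma moment4_dual (L : StrongDual ℝ E) (h0 : ∫ x, L x ∂μ = 0) :
    ∫ x, L x ^ 4 ∂μ = 3 * (∫ x, L x ^ 2 ∂μ) ^ 2 := by
  have h := IsGaussian.map_eq_gaussianReal (μ := μ) L
  have e : ∫ x, L x ^ 4 ∂μ = ∫ y, y ^ 4 ∂(μ.map L) := by
    rw [integral_map (by fun_prop) (by fun_prop)]
  rw [e, h, h0, moment4_gaussianReal, Real.coe_toNNReal _ (variance_nonneg _ _),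
    variance_of_integral_eq_zero (by fun_prop) h0]

lemma int2_dual (A B : StrongDual ℝ E) : Integrable (fun x ↦ A x * B x) μ :=
  (IsGaussian.memLp_dual μ A 2 (by simp)).integrable_mul (IsGaussian.memLp_dual μ B 2 (by simp))

lemma int4_dual (A : StrongDual ℝ E) : Integrable (fun x ↦ A x ^ 4) μ := by
  have := (IsGaussian.memLp_dual μ A 4 (by simp)).integrable_norm_pow (by norm_num)
  refine this.congr (Filter.Eventually.of_forall fun x ↦ ?_)
  simp [Real.norm_eq_abs, (by decide : Even 4).pow_abs]

lemma quad_ident (s a b : ℝ) : s * a * (s * b) = (1/48 : ℝ) * (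
    (s + a + b) ^ 4 + (s - a - b) ^ 4 - (s + a - b) ^ 4 - (s - a + b) ^ 4
      - 2 * (a + b) ^ 4 + 2 * (a - b) ^ 4) := by ring

lemma int22_dual (S A B : StrongDual ℝ E) : Integrable (fun x ↦ S x * A x * (S x * B x)) μ := by
  simp_rw [quad_ident]
  refine Integrable.const_mul ?_ _
  exact (((((int4_dual (S + A + B)).add (int4_dual (S - A - B))).sub (int4_dual (S + A - B))).sub
    (int4_dual (S - A + B))).sub ((int4_dual (A + B)).const_mul 2)).add
      ((int4_dual (A - B)).const_mul 2)

lemma isserlis_dual (h0 : ∀ L : StrongDual ℝ E, ∫ x, L x ∂μ = 0) (S A B : StrongDual ℝ E) :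
    ∫ x, S x * A x * (S x * B x) ∂μ = (∫ x, S x * S x ∂μ) * (∫ x, A x * B x ∂μ)
      + 2 * (∫ x, S x * A x ∂μ) * (∫ x, S x * B x ∂μ) := by
  have key : ∀ r p q : ℝ, ∫ x, (r * S x + p * A x + q * B x) ^ 4 ∂μ = 3 * (
      r ^ 2 * (∫ x, S x * S x ∂μ) + p ^ 2 * (∫ x, A x * A x ∂μ) + q ^ 2 * (∫ x, B x * B x ∂μ)
      + 2 * r * p * (∫ x, S x * A x ∂μ) + 2 * r * q * (∫ x, S x * B x ∂μ)
      + 2 * p * q * (∫ x, A x * B x ∂μ)) ^ 2 := by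
    intro r p q
    have := moment4_dual (μ := μ) (r • S + p • A + q • B) (h0 _)
    simp only [FunLike.coe_add, Pi.add_apply, FunLike.coe_smul, Pi.smul_apply, smul_eq_mul] at this
    rw [this]
    congr 2
    have e : ∀ x, (r * S x + p * A x + q * B x) ^ 2 = r ^ 2 * (S x * S x) + p ^ 2 * (A x * A x)
      + q ^ 2 * (B x * B x) + 2 * r * p * (S x * A x) + 2 * r * q * (S x * B x)
      + 2 * p * q * (A x * B x) := fun x ↦ by ring
    simp_rw [e]
    have i := fun (c : ℝ) (A B : StrongDual ℝ E) ↦ (int2_dual (μ := μ) A B).const_mul c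
    rw [integral_add (((((i _ S S).fun_add (i _ A A)).fun_add (i _ B B)).fun_add (i _ S A)).fun_add (i _ S B))
        (i _ A B),
      integral_add ((((i _ S S).fun_add (i _ A A)).fun_add (i _ B B)).fun_add (i _ S A)) (i _ S B),
      integral_add (((i _ S S).fun_add (i _ A A)).fun_add (i _ B B)) (i _ S A),
      integral_add ((i _ S S).fun_add (i _ A A)) (i _ B B),
      integral_add (i _ S S) (i _ A A)]
    simp only [integral_const_mul]
  have e : ∀ x, S x * A x * (S x * B x) = (1/48 : ℝ) * (
    (1 * S x + 1 * A x + 1 * B x) ^ 4 + (1 * S x + (-1) * A x + (-1) * B x) ^ 4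
      - (1 * S x + 1 * A x + (-1) * B x) ^ 4 - (1 * S x + (-1) * A x + 1 * B x) ^ 4
      - 2 * (0 * S x + 1 * A x + 1 * B x) ^ 4 + 2 * (0 * S x + 1 * A x + (-1) * B x) ^ 4) :=
    fun x ↦ by ring
  have i : ∀ r p q : ℝ, Integrable (fun x ↦ (r * S x + p * A x + q * B x) ^ 4) μ :=
    fun r p q ↦ int4_dual (μ := μ) (r • S + p • A + q • B)
  simp_rw [e]
  rw [integral_const_mul,
    integral_add (((((i _ _ _).fun_add (i _ _ _)).fun_subF (i _ _ _)).fun_subF (i _ _ _)).fun_subF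
      ((i _ _ _).const_mul 2)) ((i _ _ _).const_mul 2),
    integral_sub ((((i _ _ _).fun_add (i _ _ _)).fun_subF (i _ _ _)).fun_subF (i _ _ _))
      ((i _ _ _).const_mul 2),
    integral_sub (((i _ _ _).fun_add (i _ _ _)).fun_subF (i _ _ _)) (i _ _ _),
    integral_sub ((i _ _ _).fun_add (i _ _ _)) (i _ _ _),
    integral_add (i _ _ _) (i _ _ _)]
  simp only [integral_const_mul, key]
  ring
end
/-- The linear functional `(x, y) ↦ u ⬝ x + s y`. -/
noncomputable def linF {N : ℕ} (u : Fin N → ℝ) (s : ℝ) : StrongDual ℝ ((Fin N → ℝ) × ℝ) :=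
  LinearMap.toContinuousLinearMap
    { toFun := fun ω ↦ u ⬝ᵥ ω.1 + s * ω.2
      map_add' := fun x y ↦ by simp [dotProduct_add]; ring
      map_smul' := fun c x ↦ by simp [dotProduct_smul]; ring }

lemma linF_apply {N : ℕ} (u : Fin N → ℝ) (s : ℝ) (ω : (Fin N → ℝ) × ℝ) :
    linF u s ω = u ⬝ᵥ ω.1 + s * ω.2 := rfl

/-- The joint law of `(g, ε)`. -/
noncomputable abbrev muF (N : ℕ) (σ2 : NNReal) : Measure ((Fin N → ℝ) × ℝ) :=
  (Measure.pi fun _ : Fin N => gaussianReal 0 1).prod (gaussianReal 0 σ2)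

instance isGaussian_piF (N : ℕ) : IsGaussian (Measure.pi fun _ : Fin N => gaussianReal 0 1) := by
  have h : HasGaussianLaw (fun ω : Fin N → ℝ ↦ (fun i ↦ ω i))
      (Measure.pi fun _ : Fin N => gaussianReal 0 1) := by
    refine iIndepFun.hasGaussianLaw (X := fun i (ω : Fin N → ℝ) ↦ ω i) (fun i ↦ ⟨?_⟩) ?_
    · rw [show (fun ω : Fin N → ℝ ↦ ω i) = Function.eval i from rfl,
        (measurePreserving_eval (fun _ : Fin N => gaussianReal 0 1) i).map_eq]
      infer_instance
    · exact iIndepFun_pi (X := fun _ ↦ id) (fun _ ↦ aemeasurable_id)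
  have := h.isGaussian_map
  rwa [show (fun ω : Fin N → ℝ ↦ (fun i ↦ ω i)) = id from rfl, Measure.map_id] at this

instance isGaussian_muF (N : ℕ) (σ2 : NNReal) : IsGaussian (muF N σ2) := by
  unfold muF; infer_instance

lemma mean_dualF (N : ℕ) (σ2 : NNReal) (L : StrongDual ℝ ((Fin N → ℝ) × ℝ)) :
    ∫ ω, L ω ∂(muF N σ2) = 0 := by
  have hint : Integrable (fun ω ↦ ω) (muF N σ2) := IsGaussian.integrable_id
  rw [ContinuousLinearMap.integral_comp_comm L hint]
  have h1 : (∫ ω, ω ∂(muF N σ2)).1 = 0 := by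
    have := ContinuousLinearMap.integral_comp_comm (ContinuousLinearMap.fst ℝ (Fin N → ℝ) ℝ) hint
    simp only [ContinuousLinearMap.coe_fst'] at this
    rw [← this, integral_fun_fst (fun x ↦ x)]
    ext i
    have h2 := ContinuousLinearMap.integral_comp_comm
      (ContinuousLinearMap.proj (R := ℝ) (φ := fun _ : Fin N ↦ ℝ) i)
      (IsGaussian.integrable_id (μ := Measure.pi fun _ : Fin N => gaussianReal 0 1))
    simp only [ContinuousLinearMap.proj_apply, id] at h2
    have h3 := integral_comp_eval (μ := fun _ : Fin N => gaussianReal 0 1) (i := i)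
      (f := fun x : ℝ ↦ x) (by fun_prop)
    simp at h3
    simp [← h2, h3]
  have h2 : (∫ ω, ω ∂(muF N σ2)).2 = 0 := by
    have := ContinuousLinearMap.integral_comp_comm (ContinuousLinearMap.snd ℝ (Fin N → ℝ) ℝ) hint
    simp only [ContinuousLinearMap.coe_snd'] at this
    rw [← this, integral_fun_snd (fun x ↦ x)]
    simp
  rw [show (∫ ω, ω ∂(muF N σ2)) = 0 from Prod.ext h1 h2, map_zero]

lemma sq_linF (N : ℕ) (σ2 : NNReal) (u : Fin N → ℝ) (s : ℝ) :
    ∫ ω, linF u s ω ^ 2 ∂(muF N σ2) = u ⬝ᵥ u + s ^ 2 * σ2 := by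
  rw [← variance_of_integral_eq_zero (by fun_prop) (mean_dualF N σ2 _)]
  have hu : (fun x : Fin N → ℝ ↦ u ⬝ᵥ x) = ∑ i, fun x : Fin N → ℝ ↦ (fun y ↦ u i * y) (x i) := by
    ext x; simp [dotProduct]
  have hm : ∀ (v : NNReal) (c : ℝ), MemLp (fun y ↦ c * y) 2 (gaussianReal 0 v) :=
    fun v c ↦ (memLp_id_gaussianReal' 2 (by simp)).const_mul c
  have hv : Var[fun x : Fin N → ℝ ↦ u ⬝ᵥ x; Measure.pi fun _ : Fin N => gaussianReal 0 1]
      = u ⬝ᵥ u := by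
    rw [hu, variance_sum_pi (fun i ↦ hm _ _)]
    simp only [dotProduct]
    refine Finset.sum_congr rfl fun i _ ↦ ?_
    rw [variance_const_mul, variance_fun_id_gaussianReal]
    simp [sq]
  have hmu : MemLp (fun x : Fin N → ℝ ↦ u ⬝ᵥ x) 2
      (Measure.pi fun _ : Fin N => gaussianReal 0 1) := by
    rw [hu]
    refine memLp_finsetSum' _ fun i _ ↦ ?_
    exact (hm 1 (u i)).comp_measurePreserving
      (measurePreserving_eval (fun _ : Fin N => gaussianReal 0 1) i)
  have := variance_add_prod hmu (hm σ2 s)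
  rw [hv, variance_const_mul, variance_fun_id_gaussianReal] at this
  exact this

lemma cov_linF (N : ℕ) (σ2 : NNReal) (u w : Fin N → ℝ) (s t : ℝ) :
    ∫ ω, linF u s ω * linF w t ω ∂(muF N σ2) = u ⬝ᵥ w + s * t * σ2 := by
  have e : ∀ ω, linF u s ω * linF w t ω =
      (1/4 : ℝ) * (linF (u + w) (s + t) ω ^ 2 - linF (u - w) (s - t) ω ^ 2) := by
    intro ω
    simp only [linF_apply, add_dotProduct, sub_dotProduct]
    ring
  have i : ∀ L : StrongDual ℝ ((Fin N → ℝ) × ℝ), Integrable (fun ω ↦ L ω ^ 2) (muF N σ2) :=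
    fun L ↦ by simpa only [sq] using int2_dual L L
  simp_rw [e]
  rw [integral_const_mul, integral_sub (i _) (i _), sq_linF, sq_linF]
  simp only [add_dotProduct, sub_dotProduct, dotProduct_add, dotProduct_sub, dotProduct_comm w u]
  ring


/-- Quality-aware anisotropic noise lemma: for `φ = A g` (`g` a vector of `N`
independent standard Gaussians), `H = A Aᵀ`, and an independent centered Gaussian
label noise `ε` with variance `σ² ≥ 0`, the stochastic gradient
`X = (⟨φ,e⟩ - ε)·φ` satisfies: (i) `E[X] = H e`; (ii) `Cov(X) = H e eᵀ H + (eᵀHe)H + σ²H`;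
(iii) `(eᵀHe + σ²)·H ⪯ Cov(X) ⪯ (2 eᵀHe + σ²)·H` in the Loewner order; in particular,
for every unit eigenvector `v` of `H` with eigenvalue `λ`,
`(eᵀHe + σ²)λ ≤ vᵀ Cov(X) v ≤ (2 eᵀHe + σ²)λ`. -/
theorem stmt_2 (N : ℕ) (A : Matrix (Fin N) (Fin N) ℝ) (σ2 : NNReal) (e : Fin N → ℝ) :
    let μ : Measure ((Fin N → ℝ) × ℝ) :=
      (Measure.pi fun _ : Fin N => gaussianReal 0 1).prod (gaussianReal 0 σ2)
    let H : Matrix (Fin N) (Fin N) ℝ := A * Aᵀ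
    let X : ((Fin N → ℝ) × ℝ) → (Fin N → ℝ) :=
      fun ω => ((A *ᵥ ω.1) ⬝ᵥ e - ω.2) • (A *ᵥ ω.1)
    let Cov : Matrix (Fin N) (Fin N) ℝ :=
      Matrix.of fun i j : Fin N =>
        ∫ ω, (X ω i - (H *ᵥ e) i) * (X ω j - (H *ᵥ e) j) ∂μ
    (∀ i : Fin N, (∫ ω, X ω i ∂μ) = (H *ᵥ e) i) ∧
    Cov = H * Matrix.vecMulVec e e * H + (e ⬝ᵥ H *ᵥ e) • H + (σ2 : ℝ) • H ∧
    (Cov - (e ⬝ᵥ H *ᵥ e + (σ2 : ℝ)) • H).PosSemidef ∧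
    ((2 * (e ⬝ᵥ H *ᵥ e) + (σ2 : ℝ)) • H - Cov).PosSemidef ∧
    (∀ (v : Fin N → ℝ) (lam : ℝ), H *ᵥ v = lam • v → v ⬝ᵥ v = 1 →
      (e ⬝ᵥ H *ᵥ e + (σ2 : ℝ)) * lam ≤ v ⬝ᵥ Cov *ᵥ v ∧
      v ⬝ᵥ Cov *ᵥ v ≤ (2 * (e ⬝ᵥ H *ᵥ e) + (σ2 : ℝ)) * lam) := by

  intro μ H X Cov
  set a : Fin N → ℝ := Aᵀ *ᵥ e with ha
  have hHe : ∀ v, H *ᵥ v = A *ᵥ (Aᵀ *ᵥ v) := fun v ↦ by simp [H, mulVec_mulVec]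
  have hq : ∀ v w : Fin N → ℝ, v ⬝ᵥ H *ᵥ w = (Aᵀ *ᵥ v) ⬝ᵥ (Aᵀ *ᵥ w) := fun v w ↦ by
    rw [hHe, dotProduct_mulVec, ← mulVec_transpose]
  have hX : ∀ ω i, X ω i = linF a (-1) ω * linF (A i) 0 ω := by
    intro ω i
    simp only [X, linF_apply, Pi.smul_apply, smul_eq_mul, ha]
    rw [dotProduct_comm, dotProduct_mulVec, ← mulVec_transpose]
    simp only [mulVec]
    ring
  have hHei : ∀ i, (H *ᵥ e) i = a ⬝ᵥ A i := fun i ↦ by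
    rw [hHe, dotProduct_comm]; rfl
  have hHij : ∀ i j, H i j = A i ⬝ᵥ A j := fun i j ↦ rfl
  have hmean : ∀ i : Fin N, (∫ ω, X ω i ∂μ) = (H *ᵥ e) i := by
    intro i
    simp_rw [hX, hHei]
    have := cov_linF N σ2 a (A i) (-1) 0
    simpa using this
  have hHs : Hᵀ = H := by simp [H]
  have hvec : H * vecMulVec e e * H = vecMulVec (H *ᵥ e) (H *ᵥ e) := by
    rw [mul_vecMulVec, vecMulVec_mul, ← mulVec_transpose, hHs]
  have hCov : Cov = H * Matrix.vecMulVec e e * H + (e ⬝ᵥ H *ᵥ e) • H + (σ2 : ℝ) • H := by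
    rw [hvec]
    ext i j
    simp only [Cov, of_apply, Matrix.add_apply, Matrix.smul_apply, vecMulVec_apply, smul_eq_mul]
    set c := (H *ᵥ e) i with hc
    set d := (H *ᵥ e) j with hd
    have e1 : ∀ ω, (X ω i - c) * (X ω j - d) = X ω i * X ω j - d * X ω i - c * X ω j + c * d :=
      fun ω ↦ by ring
    simp_rw [e1]
    have iX : ∀ i, Integrable (fun ω ↦ X ω i) μ := fun i ↦ by
      simp_rw [hX]; exact int2_dual (μ := muF N σ2) _ _
    have iXX : Integrable (fun ω ↦ X ω i * X ω j) μ := by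
      simp_rw [hX]; exact int22_dual (μ := muF N σ2) _ _ _
    have hXX : ∫ ω, X ω i * X ω j ∂μ = (a ⬝ᵥ a + σ2) * (A i ⬝ᵥ A j) + 2 * c * d := by
      simp_rw [hX]
      have := isserlis_dual (mean_dualF N σ2) (linF a (-1)) (linF (A i) 0) (linF (A j) 0)
      rw [cov_linF, cov_linF, cov_linF, cov_linF] at this
      rw [hc, hd, hHei, hHei]
      refine this.trans ?_
      ring
    rw [integral_add ((iXX.fun_subF ((iX i).const_mul d)).fun_subF ((iX j).const_mul c))
        (integrable_const _),
      integral_sub (iXX.fun_subF ((iX i).const_mul d)) ((iX j).const_mul c),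
      integral_sub iXX ((iX i).const_mul d), integral_const_mul, integral_const_mul,
      hmean, hmean, hXX, integral_const, hq, hHij, ← hc, ← hd, ← ha]
    simp
    ring
  have hlow : (Cov - (e ⬝ᵥ H *ᵥ e + (σ2 : ℝ)) • H).PosSemidef := by
    have : Cov - (e ⬝ᵥ H *ᵥ e + (σ2 : ℝ)) • H = vecMulVec (H *ᵥ e) (star (H *ᵥ e)) := by
      rw [hCov, hvec, add_smul, star_trivial]; abel
    rw [this]
    exact posSemidef_vecMulVec_self_star _
  have hup : ((2 * (e ⬝ᵥ H *ᵥ e) + (σ2 : ℝ)) • H - Cov).PosSemidef := by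
    have h1 : (2 * (e ⬝ᵥ H *ᵥ e) + (σ2 : ℝ)) • H - Cov
        = (e ⬝ᵥ H *ᵥ e) • H - vecMulVec (H *ᵥ e) (H *ᵥ e) := by
      rw [hCov, hvec, add_smul, two_mul, add_smul]; abel
    rw [h1]
    refine PosSemidef.of_dotProduct_mulVec_nonneg ?_ fun v ↦ ?_
    · rw [IsHermitian, conjTranspose_eq_transpose_of_trivial, transpose_sub, transpose_smul, hHs,
        transpose_vecMulVec]
    · rw [star_trivial, sub_mulVec, smul_mulVec, dotProduct_sub, dotProduct_smul,
        vecMulVec_mulVec, smul_eq_mul, hq e e, hq v v]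
      have h2 : v ⬝ᵥ (MulOpposite.op ((H *ᵥ e) ⬝ᵥ v) • (H *ᵥ e))
          = ((Aᵀ *ᵥ v) ⬝ᵥ (Aᵀ *ᵥ e)) ^ 2 := by
        rw [op_smul_eq_smul, dotProduct_smul, dotProduct_comm (H *ᵥ e) v, hq, smul_eq_mul, sq]
      rw [h2]
      have := Finset.sum_mul_sq_le_sq_mul_sq Finset.univ (Aᵀ *ᵥ v) (Aᵀ *ᵥ e)
      simp only [dotProduct, ← sq]
      linarith
  refine ⟨hmean, hCov, hlow, hup, fun v lam hv h1 ↦ ?_⟩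
  have hl := hlow.dotProduct_mulVec_nonneg v
  have hu := hup.dotProduct_mulVec_nonneg v
  rw [star_trivial, sub_mulVec, smul_mulVec, dotProduct_sub, dotProduct_smul, hv,
    dotProduct_smul, h1] at hl hu
  simp only [smul_eq_mul, mul_one] at hl hu
  constructor <;> linarith
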